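/- Consider the CLTSP with general processing times, only deadlines (r(a) = 0 for all a ∈ A) and slow clients (0 < v < 1). If the instance admits a feasible solution, then there exists an optimal solution (t, x) in which the server is wait-free, i.e., t_i = c_{i−1} + |x_i − x_{i−1}| for all 1 ≤ i ≤ n+1. -/

import Mathlib

open scoped BigOperators

/-- An instance of the collaborative line TSP/TRP: a finite set of `n` clients,
a client speed `v > 0`, and for each client a start position `s`, release date
`r ≥ 0`, deadline `d ∈ [0, ∞]` and processing time `tau ≥ 0`. -/
structure CInstance (n : ℕ) where
  v : ℝ
  s : Fin n → ℝ
  r : Fin n → ℝ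
  d : Fin n → EReal
  tau : Fin n → ℝ
  hv : 0 < v
  hr : ∀ a, 0 ≤ r a
  hd : ∀ a, (0 : EReal) ≤ d a
  htau : ∀ a, 0 ≤ tau a

/-- A solution: a serving order `σ` (the `i`-th rendezvous, `i = 0, …, n-1`
in zero-based counting, serves client `σ i`), a rendezvous time `t a` and a
rendezvous position `x a` for every client `a`, and a final time `tEnd` at
which the server is back at the origin. -/
structure CSolution (n : ℕ) where
  σ : Equiv.Perm (Fin n)
  t : Fin n → ℝ
  x : Fin n → ℝ
  tEnd : ℝ

namespace CLTSP

variable {n : ℕ}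

/-- Position `x_i` of the `i`-th server stop, `i = 0, …, n+1`; `x_0 = x_{n+1} = 0`. -/
def pos (sol : CSolution n) (i : ℕ) : ℝ :=
  if h : 1 ≤ i ∧ i ≤ n then sol.x (sol.σ ⟨i - 1, by omega⟩) else 0

/-- Time `t_i` of the `i`-th server stop, `i = 0, …, n+1`; `t_0 = 0`, `t_{n+1} = tEnd`. -/
def time (sol : CSolution n) (i : ℕ) : ℝ :=
  if h : 1 ≤ i ∧ i ≤ n then sol.t (sol.σ ⟨i - 1, by omega⟩)
  else if i = 0 then 0 else sol.tEnd

/-- Completion time `c_i` of the `i`-th rendezvous: `c_0 = 0`,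
`c_i = t_i + τ(σ_i)` for `1 ≤ i ≤ n`, and `c_{n+1} = tEnd`. -/
def comp (I : CInstance n) (sol : CSolution n) (i : ℕ) : ℝ :=
  if h : 1 ≤ i ∧ i ≤ n then
    sol.t (sol.σ ⟨i - 1, by omega⟩) + I.tau (sol.σ ⟨i - 1, by omega⟩)
  else if i = 0 then 0 else sol.tEnd

/-- Feasibility: every rendezvous (including the final return to the origin) is
reachable by the server, every rendezvous is reachable by the corresponding
client, and every client is served within its time window. -/
def Feasible (I : CInstance n) (sol : CSolution n) : Prop :=
  (∀ i : ℕ, 1 ≤ i → i ≤ n + 1 →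
      comp I sol (i - 1) + |pos sol i - pos sol (i - 1)| ≤ time sol i) ∧
  (∀ a, I.r a + |sol.x a - I.s a| / I.v ≤ sol.t a) ∧
  (∀ a, I.r a ≤ sol.t a ∧ (sol.t a : EReal) ≤ I.d a)

/-- The makespan `C_max = c_{n+1}`. -/
def makespan (sol : CSolution n) : ℝ := sol.tEnd

/-- The sum of completion times `C_sum = ∑_{i=1}^n c_i = ∑_a (t a + τ a)`. -/
def csum (I : CInstance n) (sol : CSolution n) : ℝ :=
  ∑ a : Fin n, (sol.t a + I.tau a)

/-- An optimal CLTSP solution: feasible with minimum makespan. -/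
def OptimalTSP (I : CInstance n) (sol : CSolution n) : Prop :=
  Feasible I sol ∧ ∀ sol' : CSolution n, Feasible I sol' → makespan sol ≤ makespan sol'

/-- An optimal CLTRP solution: feasible with minimum sum of completion times. -/
def OptimalTRP (I : CInstance n) (sol : CSolution n) : Prop :=
  Feasible I sol ∧ ∀ sol' : CSolution n, Feasible I sol' → csum I sol ≤ csum I sol'

/-- Order-preserving: for clients `a, a'` both in `L = {a : s a ≤ 0}` or both in
`R = {a : 0 < s a}` with `|s a| < |s a'|` we have `t a < t a'`. -/
def OrderPreserving (I : CInstance n) (sol : CSolution n) : Prop :=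
  ∀ a a' : Fin n,
    ((I.s a ≤ 0 ∧ I.s a' ≤ 0) ∨ (0 < I.s a ∧ 0 < I.s a')) →
    |I.s a| < |I.s a'| → sol.t a < sol.t a'

/-- Wait-free server: `t_i = c_{i-1} + |x_i - x_{i-1}|` for all `1 ≤ i ≤ n+1`. -/
def WaitFree (I : CInstance n) (sol : CSolution n) : Prop :=
  ∀ i : ℕ, 1 ≤ i → i ≤ n + 1 →
    time sol i = comp I sol (i - 1) + |pos sol i - pos sol (i - 1)|

/-- Colliding clients: each client `a = σ_i` satisfies
`t a = max (r a + |s a - x a| / v) (c_{i-1})`. -/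
def Colliding (I : CInstance n) (sol : CSolution n) : Prop :=
  ∀ a : Fin n,
    sol.t a = max (I.r a + |I.s a - sol.x a| / I.v)
      (comp I sol ((sol.σ.symm a : ℕ)))

end CLTSP

namespace CLTSP

variable {n : ℕ}

/-- From position `x` at time `c`, a unit-speed server can meet a slow client starting at `s`
without waiting, in such a way that any other possible meeting `(t, y)` remains reachable. -/
lemma exists_greedy_meeting {v : ℝ} (hv : 0 < v) (hv1 : v < 1) (s x c : ℝ) :
    ∃ T p : ℝ, 0 ≤ c → T = c + |p - x| ∧ |p - s| ≤ v * T ∧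
      ∀ t y : ℝ, |y - s| ≤ v * t → c + |y - x| ≤ t → T + |y - p| ≤ t := by
  by_cases hin : |x - s| ≤ v * c
  · exact ⟨c, x, fun _ => ⟨by simp, hin, fun t y _ h => h⟩⟩
  push Not at hin
  -- `T` is the time at which server and client meet when they move towards each other.
  obtain ⟨T, hT⟩ : ∃ T, (1 + v) * T = |x - s| + c :=
    ⟨(|x - s| + c) / (1 + v), by field_simp⟩
  rcases le_total x s with hxs | hxs
  · rw [abs_of_nonpos (by linarith)] at hin hT
    refine ⟨T, s - v * T, fun hc => ?_⟩
    have hcT : c ≤ T := by nlinarith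
    refine ⟨?_, ?_, fun t y hy hyt => ?_⟩
    · rw [abs_of_nonneg (by linarith)]; linarith
    · rw [abs_of_nonpos (by nlinarith)]; linarith
    · have h1 := (abs_le.mp hy).1
      have h2 := le_abs_self (y - x)
      have hTt : T ≤ t := by nlinarith
      have h3 : v * (t - T) ≤ t - T := by nlinarith
      have h4 : |y - (s - v * T)| ≤ t - T := abs_le.mpr ⟨by linarith, by linarith⟩
      linarith
  · rw [abs_of_nonneg (by linarith)] at hin hT
    refine ⟨T, s + v * T, fun hc => ?_⟩
    have hcT : c ≤ T := by nlinarith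
    refine ⟨?_, ?_, fun t y hy hyt => ?_⟩
    · rw [abs_of_nonpos (by linarith)]; linarith
    · rw [abs_of_nonneg (by nlinarith)]; linarith
    · have h1 := (abs_le.mp hy).2
      have h2 := neg_abs_le (y - x)
      have hTt : T ≤ t := by nlinarith
      have h3 : v * (t - T) ≤ t - T := by nlinarith
      have h4 : |y - (s + v * T)| ≤ t - T := abs_le.mpr ⟨by linarith, by linarith⟩
      linarith

lemma time_succ (sol : CSolution n) {k : ℕ} (hk : k < n) :
    time sol (k + 1) = sol.t (sol.σ ⟨k, hk⟩) := by
  simp [time, hk]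

lemma pos_succ (sol : CSolution n) {k : ℕ} (hk : k < n) :
    pos sol (k + 1) = sol.x (sol.σ ⟨k, hk⟩) := by
  simp [pos, hk]

lemma comp_succ (I : CInstance n) (sol : CSolution n) {k : ℕ} (hk : k < n) :
    comp I sol (k + 1) = time sol (k + 1) + I.tau (sol.σ ⟨k, hk⟩) := by
  simp [comp, time, hk]

lemma pos_zero (sol : CSolution n) : pos sol 0 = 0 := by simp [pos]

lemma comp_zero (I : CInstance n) (sol : CSolution n) : comp I sol 0 = 0 := by simp [comp]

lemma pos_end (sol : CSolution n) : pos sol (n + 1) = 0 := by simp [pos]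

lemma time_end (sol : CSolution n) : time sol (n + 1) = sol.tEnd := by simp [time]

/-- The position and completion time of the server after serving the first `k` clients in the
order `σ`, when it meets client `a` from position `x` and time `c` at position `p a x c` and
time `T a x c`. -/
def serverState (I : CInstance n) (T p : Fin n → ℝ → ℝ → ℝ) (σ : Equiv.Perm (Fin n)) :
    ℕ → ℝ × ℝ
  | 0 => (0, 0)
  | k + 1 =>
    let q := serverState I T p σ k
    if h : k < n then
      (p (σ ⟨k, h⟩) q.1 q.2, T (σ ⟨k, h⟩) q.1 q.2 + I.tau (σ ⟨k, h⟩))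
    else q

/-- The solution serving the clients in the order `σ` with the meetings of `serverState`. -/
def serverSolution (I : CInstance n) (T p : Fin n → ℝ → ℝ → ℝ) (σ : Equiv.Perm (Fin n)) :
    CSolution n where
  σ := σ
  t a := T a (serverState I T p σ (σ.symm a)).1 (serverState I T p σ (σ.symm a)).2
  x a := p a (serverState I T p σ (σ.symm a)).1 (serverState I T p σ (σ.symm a)).2
  tEnd := (serverState I T p σ n).2 + |(serverState I T p σ n).1|

lemma serverSolution_t (I : CInstance n) (T p : Fin n → ℝ → ℝ → ℝ) (σ : Equiv.Perm (Fin n))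
    {k : ℕ} (hk : k < n) :
    (serverSolution I T p σ).t (σ ⟨k, hk⟩) =
      T (σ ⟨k, hk⟩) (serverState I T p σ k).1 (serverState I T p σ k).2 := by
  simp [serverSolution]

lemma serverSolution_x (I : CInstance n) (T p : Fin n → ℝ → ℝ → ℝ) (σ : Equiv.Perm (Fin n))
    {k : ℕ} (hk : k < n) :
    (serverSolution I T p σ).x (σ ⟨k, hk⟩) =
      p (σ ⟨k, hk⟩) (serverState I T p σ k).1 (serverState I T p σ k).2 := by
  simp [serverSolution]

lemma serverState_eq (I : CInstance n) (T p : Fin n → ℝ → ℝ → ℝ) (σ : Equiv.Perm (Fin n))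
    {k : ℕ} (hk : k ≤ n) :
    serverState I T p σ k =
      (pos (serverSolution I T p σ) k, comp I (serverSolution I T p σ) k) := by
  cases k with
  | zero => simp [serverState, pos_zero, comp_zero]
  | succ k =>
    have hk' : k < n := hk
    rw [pos_succ _ hk', comp_succ _ _ hk', time_succ _ hk']
    simp [serverState, serverSolution, hk']

/-- For every serving order there is a wait-free solution dominating all feasible solutions with
that order. -/
lemma exists_waitFree_dominating (I : CInstance n) (hrel : ∀ a, I.r a = 0) (hslow : I.v < 1)
    (σ : Equiv.Perm (Fin n)) :
    ∃ G : CSolution n, WaitFree I G ∧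
      ∀ sol : CSolution n, Feasible I sol → sol.σ = σ →
        Feasible I G ∧ makespan G ≤ makespan sol := by
  have hmeet := fun a x c => exists_greedy_meeting I.hv hslow (I.s a) x c
  choose T p hTp using hmeet
  let G := serverSolution I T p σ
  have hstep (k : ℕ) (hk : k < n) :
      time G (k + 1) = T (σ ⟨k, hk⟩) (pos G k) (comp I G k) ∧
        pos G (k + 1) = p (σ ⟨k, hk⟩) (pos G k) (comp I G k) := by
    have h : serverState I T p σ k = (pos G k, comp I G k) := serverState_eq I T p σ hk.le
    have hpos : pos G k = (serverState I T p σ k).1 := by rw [h]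
    have hcomp : comp I G k = (serverState I T p σ k).2 := by rw [h]
    rw [time_succ _ hk, pos_succ _ hk, hpos, hcomp]
    exact ⟨serverSolution_t I T p σ hk, serverSolution_x I T p σ hk⟩
  have hnonneg (k : ℕ) (hk : k ≤ n) : 0 ≤ comp I G k := by
    induction k with
    | zero => simp [comp_zero]
    | succ k ih =>
      rw [comp_succ I G hk, (hstep k hk).1, (hTp _ _ _ (ih (by omega))).1]
      have := ih (by omega)
      have := I.htau (G.σ ⟨k, hk⟩)
      positivity
  have hspec (k : ℕ) (hk : k < n) :
      time G (k + 1) = comp I G k + |pos G (k + 1) - pos G k| ∧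
      |pos G (k + 1) - I.s (σ ⟨k, hk⟩)| ≤ I.v * time G (k + 1) ∧
      ∀ t y : ℝ, |y - I.s (σ ⟨k, hk⟩)| ≤ I.v * t → comp I G k + |y - pos G k| ≤ t →
        time G (k + 1) + |y - pos G (k + 1)| ≤ t := by
    rw [(hstep k hk).1, (hstep k hk).2]
    exact hTp _ _ _ (hnonneg k hk.le)
  have hend : G.tEnd = comp I G n + |pos G n| := by
    change (serverState I T p σ n).2 + |(serverState I T p σ n).1| = _
    rw [serverState_eq I T p σ le_rfl]
  have hwait : WaitFree I G := by
    intro i h1 h2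
    obtain ⟨k, rfl⟩ := Nat.exists_eq_add_of_le' h1
    rcases (show k < n ∨ k = n by omega) with hk | rfl
    · exact (hspec k hk).1
    · simp [time_end, pos_end, hend]
  refine ⟨G, hwait, ?_⟩
  rintro sol ⟨hserver, hclient, hdead⟩ rfl
  have hmeets (k : ℕ) (hk : k < n)
      (ih : comp I G k + |pos sol k - pos G k| ≤ comp I sol k) :
      time G (k + 1) + |pos sol (k + 1) - pos G (k + 1)| ≤ time sol (k + 1) := by
    refine (hspec k hk).2.2 _ _ ?_ ?_
    · have h := hclient (sol.σ ⟨k, hk⟩)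
      rw [hrel, zero_add, div_le_iff₀ I.hv] at h
      rw [pos_succ _ hk, time_succ _ hk]
      linarith
    · have h := hserver (k + 1) (by omega) (by omega)
      have := abs_sub_le (pos sol (k + 1)) (pos sol k) (pos G k)
      simp only [Nat.add_sub_cancel] at h
      linarith
  have hinv (k : ℕ) (hk : k ≤ n) :
      comp I G k + |pos sol k - pos G k| ≤ comp I sol k := by
    induction k with
    | zero => simp [comp_zero, pos_zero]
    | succ k ih =>
      have := hmeets k hk (ih (by omega))
      rw [comp_succ I G hk, comp_succ I sol hk]
      change _ + I.tau (sol.σ _) + _ ≤ _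
      linarith
  have hindex (a : Fin n) : ∃ k, ∃ hk : k < n, a = sol.σ ⟨k, hk⟩ :=
    ⟨sol.σ.symm a, (sol.σ.symm a).2, by simp⟩
  have hreach (a : Fin n) : I.r a + |G.x a - I.s a| / I.v ≤ G.t a := by
    obtain ⟨k, hk, rfl⟩ := hindex a
    have h := (hspec k hk).2.1
    rw [pos_succ _ hk, time_succ _ hk] at h
    rw [hrel, zero_add, div_le_iff₀ I.hv, mul_comm]
    exact h
  have hearlier (a : Fin n) : G.t a ≤ sol.t a := by
    obtain ⟨k, hk, rfl⟩ := hindex a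
    have h := hmeets k hk (hinv k hk.le)
    rw [time_succ _ hk, time_succ _ hk] at h
    exact le_of_add_le_of_nonneg_left h (abs_nonneg _)
  refine ⟨⟨fun i h1 h2 => (hwait i h1 h2).ge, hreach, fun a => ⟨?_, ?_⟩⟩, ?_⟩
  · have := hreach a
    have : 0 ≤ |G.x a - I.s a| / I.v := div_nonneg (abs_nonneg _) I.hv.le
    linarith
  · exact (EReal.coe_le_coe_iff.mpr (hearlier a)).trans (hdead a).2
  · have h := hserver (n + 1) (by omega) le_rfl
    have h' := hinv n le_rfl
    have := abs_sub_abs_le_abs_sub (pos G n) (pos sol n)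
    rw [abs_sub_comm] at this
    simp only [Nat.add_sub_cancel, pos_end, time_end, zero_sub, abs_neg] at h
    change G.tEnd ≤ sol.tEnd
    linarith

end CLTSP

open CLTSP in
/-- CLTSP with general processing times, only deadlines and slow
clients: if a feasible solution exists, there exists an optimal solution in
which the server is wait-free. -/
theorem cltsp_genProc_deadlines_slow_exists_waitFree_optimal
    {n : ℕ} (I : CInstance n)
    (hrel : ∀ a, I.r a = 0) (hslow : I.v < 1)
    (hfeas : ∃ sol : CSolution n, Feasible I sol) :
    ∃ sol : CSolution n, OptimalTSP I sol ∧ WaitFree I sol := by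
  choose G hwait hdom using exists_waitFree_dominating I hrel hslow
  obtain ⟨sol₀, h₀⟩ := hfeas
  obtain ⟨σ, hσ, hmin⟩ := Set.exists_min_image {σ | Feasible I (G σ)} (fun σ => makespan (G σ))
    (Set.toFinite _) ⟨sol₀.σ, (hdom _ sol₀ h₀ rfl).1⟩
  refine ⟨G σ, ⟨hσ, fun sol hsol => ?_⟩, hwait σ⟩
  obtain ⟨h1, h2⟩ := hdom _ sol hsol rfl
  exact (hmin _ h1).trans h2
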